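/- Let (ιₖ, pₖ)_{k∈ℤ} be an admissible sequence. If s, t ∈ ℤ satisfy s⁻ < t < s, ιₛ ∼ ιₜ, and d_{ιₛ} = 1 < d_{ιₜ}, then there exists t′ ∈ ℤ with s < t′ < s⁺ such that ι_{t′} = σ(ιₜ) and p_{t′} = pₜ + 2. -/

import Mathlib

open Set

variable {I : Type*} [Fintype I]

/-- The cardinality `dᵢ` of the `⟨σ⟩`-orbit of `i`. -/
noncomputable def orbSize (σ : Equiv.Perm I) (i : I) : ℕ :=
  Nat.card {j : I | ∃ k : ℤ, (σ ^ k) i = j}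

/-- `s⁺ = min {t | s < t, ι t = ι s}`. -/
noncomputable def splus (ιs : ℤ → I) (s : ℤ) : ℤ := sInf {t : ℤ | s < t ∧ ιs t = ιs s}

/-- `s⁻ = max {t | t < s, ι t = ι s}`. -/
noncomputable def sminus (ιs : ℤ → I) (s : ℤ) : ℤ := sSup {t : ℤ | t < s ∧ ιs t = ιs s}

/-- An admissible sequence `(ιₖ, pₖ)_{k ∈ ℤ}` in `I × ℤ`, with respect to a finite simple
graph `Δ` on `I` and an automorphism `σ` of `Δ`. -/
structure IsAdmissibleSeq (Δ : SimpleGraph I) (σ : Equiv.Perm I)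
    (ιs : ℤ → I) (p : ℤ → ℤ) : Prop where
  /-- `σ` is an automorphism of `Δ`. -/
  adj_iff : ∀ i j : I, Δ.Adj (σ i) (σ j) ↔ Δ.Adj i j
  /-- each fiber of `ιs` is unbounded above -/
  unbdd_above : ∀ (i : I) (n : ℤ), ∃ k, n < k ∧ ιs k = i
  /-- each fiber of `ιs` is unbounded below -/
  unbdd_below : ∀ (i : I) (n : ℤ), ∃ k, k < n ∧ ιs k = i
  /-- (a) `p_{s⁺} = pₛ + 2 d_{ιₛ}` -/
  ha : ∀ s : ℤ, p (splus ιs s) = p s + 2 * (orbSize σ (ιs s) : ℤ)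
  /-- (b) `pₜ = pₛ + min(d_{ιₛ}, d_{ιₜ})` whenever `ιₛ ∼ ιₜ` and `t⁻ < s < t < s⁺` -/
  hb : ∀ s t : ℤ, Δ.Adj (ιs s) (ιs t) → sminus ιs t < s → s < t → t < splus ιs s →
        p t = p s + min (orbSize σ (ιs s) : ℤ) (orbSize σ (ιs t) : ℤ)
  /-- (c) `pₜ − (pₛ + 2) ∈ 2 d_{ιₛ} ℤ` whenever `ιₜ = σ(ιₛ)` -/
  hc : ∀ s t : ℤ, ιs t = σ (ιs s) → (2 * (orbSize σ (ιs s) : ℤ)) ∣ (p t - (p s + 2))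

lemma orbSize_apply {I : Type*} (σ : Equiv.Perm I) (i : I) :
    orbSize σ (σ i) = orbSize σ i := by
  have h : {j : I | ∃ k : ℤ, (σ ^ k) (σ i) = j} = {j : I | ∃ k : ℤ, (σ ^ k) i = j} := by
    ext j
    constructor
    · rintro ⟨k, rfl⟩
      exact ⟨k + 1, by rw [zpow_add_one, Equiv.Perm.mul_apply]⟩
    · rintro ⟨k, rfl⟩
      exact ⟨k - 1, by rw [← Equiv.Perm.mul_apply, ← zpow_add_one, sub_add_cancel]⟩
  unfold orbSize
  rw [h]

lemma apply_eq_of_orbSize_eq_one {I : Type*} {σ : Equiv.Perm I} {i : I}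
    (h : orbSize σ i = 1) : σ i = i := by
  have := (Nat.card_eq_one_iff_unique.mp h).1
  exact congrArg Subtype.val (Subsingleton.elim
    (⟨σ i, 1, by simp⟩ : {j : I | ∃ k : ℤ, (σ ^ k) i = j}) ⟨i, 0, by simp⟩)

namespace IsAdmissibleSeq

variable {I : Type*} {Δ : SimpleGraph I} {σ : Equiv.Perm I} {ιs : ℤ → I} {p : ℤ → ℤ}

lemma exists_first_after (h : IsAdmissibleSeq Δ σ ιs p) (i : I) (n : ℤ) :
    ∃ k, n < k ∧ ιs k = i ∧ ∀ x, n < x → ιs x = i → k ≤ x := by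
  obtain ⟨k, ⟨h₁, h₂⟩, h₃⟩ := Int.exists_least_of_bdd (P := fun k => n < k ∧ ιs k = i)
    ⟨n, fun _ hz => hz.1.le⟩ (h.unbdd_above i n)
  exact ⟨k, h₁, h₂, fun x hx hi => h₃ x ⟨hx, hi⟩⟩

lemma exists_last_before (h : IsAdmissibleSeq Δ σ ιs p) (i : I) (n : ℤ) :
    ∃ k, k < n ∧ ιs k = i ∧ ∀ x, x < n → ιs x = i → x ≤ k := by
  obtain ⟨k, ⟨h₁, h₂⟩, h₃⟩ := Int.exists_greatest_of_bdd (P := fun k => k < n ∧ ιs k = i)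
    ⟨n, fun _ hz => hz.1.le⟩ (h.unbdd_below i n)
  exact ⟨k, h₁, h₂, fun x hx hi => h₃ x ⟨hx, hi⟩⟩

lemma isLeast_splus (h : IsAdmissibleSeq Δ σ ιs p) (s : ℤ) :
    IsLeast {t : ℤ | s < t ∧ ιs t = ιs s} (splus ιs s) := by
  obtain ⟨k, h₁, h₂, h₃⟩ := h.exists_first_after (ιs s) s
  have hk : IsLeast {t : ℤ | s < t ∧ ιs t = ιs s} k := ⟨⟨h₁, h₂⟩, fun x hx => h₃ x hx.1 hx.2⟩
  rwa [splus, hk.csInf_eq]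

lemma isGreatest_sminus (h : IsAdmissibleSeq Δ σ ιs p) (s : ℤ) :
    IsGreatest {t : ℤ | t < s ∧ ιs t = ιs s} (sminus ιs s) := by
  obtain ⟨k, h₁, h₂, h₃⟩ := h.exists_last_before (ιs s) s
  have hk : IsGreatest {t : ℤ | t < s ∧ ιs t = ιs s} k :=
    ⟨⟨h₁, h₂⟩, fun x hx => h₃ x hx.1 hx.2⟩
  rwa [sminus, hk.csSup_eq]

lemma sminus_splus (h : IsAdmissibleSeq Δ σ ιs p) (s : ℤ) :
    sminus ιs (splus ιs s) = s := by
  obtain ⟨⟨h₁, h₂⟩, h₃⟩ := h.isLeast_splus s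
  obtain ⟨⟨h₄, h₅⟩, h₆⟩ := h.isGreatest_sminus (splus ιs s)
  refine le_antisymm (le_of_not_gt fun hlt => ?_) (h₆ ⟨h₁, h₂.symm⟩)
  exact absurd (h₃ ⟨hlt, h₅.trans h₂⟩) (not_le.mpr h₄)

lemma sminus_lt (h : IsAdmissibleSeq Δ σ ιs p) {n k : ℤ} (hne : ιs n ≠ ιs k)
    (hfirst : ∀ x, n < x → ιs x = ιs k → k ≤ x) : sminus ιs k < n := by
  obtain ⟨⟨h₁, h₂⟩, -⟩ := h.isGreatest_sminus k
  by_contra! hle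
  rcases hle.eq_or_lt with e | hlt
  · exact hne (by rw [e, h₂])
  · exact absurd (hfirst _ hlt h₂) (not_le.mpr h₁)

lemma lt_splus (h : IsAdmissibleSeq Δ σ ιs p) {n k : ℤ} (hne : ιs n ≠ ιs k)
    (hlast : ∀ x, x < n → ιs x = ιs k → x ≤ k) : n < splus ιs k := by
  obtain ⟨⟨h₁, h₂⟩, -⟩ := h.isLeast_splus k
  by_contra! hle
  rcases hle.eq_or_lt with e | hlt
  · exact hne (by rw [← e, h₂])
  · exact absurd (hlast _ hlt h₂) (not_le.mpr h₁)

lemma splus_sminus (h : IsAdmissibleSeq Δ σ ιs p) (s : ℤ) :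
    splus ιs (sminus ιs s) = s := by
  obtain ⟨⟨h₁, h₂⟩, h₃⟩ := h.isGreatest_sminus s
  obtain ⟨⟨h₄, h₅⟩, h₆⟩ := h.isLeast_splus (sminus ιs s)
  refine le_antisymm (h₆ ⟨h₁, h₂.symm⟩) (le_of_not_gt fun hlt => ?_)
  exact absurd (h₃ ⟨hlt, h₅.trans h₂⟩) (not_le.mpr h₄)

lemma le_of_le (h : IsAdmissibleSeq Δ σ ιs p) {a b : ℤ} (hι : ιs a = ιs b) (hab : a ≤ b) :
    p a ≤ p b := by
  rcases hab.eq_or_lt with rfl | hlt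
  · exact le_rfl
  · obtain ⟨⟨h₁, h₂⟩, h₃⟩ := h.isLeast_splus a
    have h₄ : splus ιs a ≤ b := h₃ ⟨hlt, hι.symm⟩
    have h₅ := h.le_of_le (h₂.trans hι) h₄
    have h₆ := h.ha a
    omega
termination_by (b - a).toNat

lemma eq_add_one (h : IsAdmissibleSeq Δ σ ιs p) {a b : ℤ} (hadj : Δ.Adj (ιs a) (ιs b))
    (hmin : min (orbSize σ (ιs a)) (orbSize σ (ιs b)) = 1)
    (h₁ : sminus ιs b < a) (h₂ : a < b) (h₃ : b < splus ιs a) : p b = p a + 1 := by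
  have := h.hb a b hadj h₁ h₂ h₃
  omega

end IsAdmissibleSeq

theorem stmt18 (Δ : SimpleGraph I) (σ : Equiv.Perm I) (ιs : ℤ → I) (p : ℤ → ℤ)
    (h : IsAdmissibleSeq Δ σ ιs p) (s t : ℤ)
    (h1 : sminus ιs s < t) (h2 : t < s)
    (hadj : Δ.Adj (ιs s) (ιs t))
    (hds : orbSize σ (ιs s) = 1) (hdt : 1 < orbSize σ (ιs t)) :
    ∃ t' : ℤ, s < t' ∧ t' < splus ιs s ∧ ιs t' = σ (ιs t) ∧ p t' = p t + 2 := by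
  have hσ : σ (ιs s) = ιs s := apply_eq_of_orbSize_eq_one hds
  have hadj' : Δ.Adj (ιs s) (σ (ιs t)) := by
    have := (h.adj_iff (ιs s) (ιs t)).mpr hadj
    rwa [hσ] at this
  have hd' : orbSize σ (σ (ιs t)) = orbSize σ (ιs t) := orbSize_apply σ (ιs t)
  obtain ⟨⟨hs₁, hs₂⟩, -⟩ := h.isLeast_splus s
  have hps : p s = p t + 1 := by
    obtain ⟨⟨hm₁, hm₂⟩, -⟩ := h.isGreatest_sminus s
    have hmp := h.splus_sminus s
    have hpm := h.ha (sminus ιs s)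
    rw [hmp, hm₂, hds] at hpm
    obtain ⟨a, ha₁, ha₂, ha₃⟩ := h.exists_first_after (ιs t) (sminus ιs s)
    obtain ⟨b, hb₁, hb₂, hb₃⟩ := h.exists_last_before (ιs t) s
    have hat : a ≤ t := ha₃ t h1 rfl
    have htb : t ≤ b := hb₃ t h2 rfl
    have hpa : p a = p (sminus ιs s) + 1 :=
      h.eq_add_one (by rwa [hm₂, ha₂]) (by rw [hm₂, ha₂]; omega)
        (h.sminus_lt (by rw [hm₂, ha₂]; exact hadj.ne) (by rwa [ha₂])) ha₁ (by omega)
    have hpb : p s = p b + 1 :=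
      h.eq_add_one (by rw [hb₂]; exact hadj.symm) (by rw [hb₂]; omega) (by omega) hb₁
        (h.lt_splus (by rw [hb₂]; exact hadj.ne) (by rwa [hb₂]))
    have := h.le_of_le ha₂ hat
    have := h.le_of_le hb₂.symm htb
    omega
  have hps' : p (splus ιs s) = p s + 2 := by
    have := h.ha s
    omega
  obtain ⟨u, hu₁, hu₂, hu₃⟩ := h.exists_last_before (σ (ιs t)) (splus ιs s)
  obtain ⟨⟨hup₁, hup₂⟩, -⟩ := h.isLeast_splus u
  have hup₃ : splus ιs s < splus ιs u :=
    h.lt_splus (by rw [hs₂, hu₂]; exact hadj'.ne) (by rwa [hu₂])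
  rcases lt_trichotomy s u with hsu | rfl | hus
  · refine ⟨u, hsu, hu₁, hu₂, ?_⟩
    have := h.eq_add_one (a := u) (b := splus ιs s) (by rw [hs₂, hu₂]; exact hadj'.symm)
      (by rw [hs₂, hu₂]; omega) (by rwa [h.sminus_splus]) hu₁ hup₃
    omega
  · exact absurd hu₂ hadj'.ne
  · exfalso
    have hpu : p u + 1 ≤ p s := by
      obtain ⟨v, hv₁, hv₂, hv₃⟩ := h.exists_first_after (ιs s) u
      have hvs : v ≤ s := hv₃ s hus rfl
      have hvm : sminus ιs v < u :=
        h.sminus_lt (by rw [hv₂, hu₂]; exact hadj'.ne') (by rwa [hv₂])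
      have h₁ := h.eq_add_one (a := u) (b := v) (by rw [hv₂, hu₂]; exact hadj'.symm)
        (by rw [hv₂, hu₂]; omega) hvm hv₁ (by omega)
      have h₂ := h.le_of_le hv₂ hvs
      omega
    have hpu' : p (splus ιs s) + 1 ≤ p (splus ιs u) := by
      obtain ⟨w, hw₁, hw₂, hw₃⟩ := h.exists_last_before (ιs s) (splus ιs u)
      have hsw : splus ιs s ≤ w := hw₃ _ hup₃ hs₂
      have hwp : splus ιs u < splus ιs w :=
        h.lt_splus (by rw [hup₂, hw₂, hu₂]; exact hadj'.ne') (by rwa [hw₂])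
      have h₁ := h.eq_add_one (a := w) (b := splus ιs u) (by rw [hw₂, hup₂, hu₂]; exact hadj')
        (by rw [hw₂, hup₂, hu₂]; omega) (by rw [h.sminus_splus]; omega) hw₁ hwp
      have h₂ := h.le_of_le (hs₂.trans hw₂.symm) hsw
      omega
    have hpu₂ := h.ha u
    rw [hu₂, hd'] at hpu₂
    have hdvd := h.hc t u hu₂
    have := Int.eq_zero_of_abs_lt_dvd hdvd (by rw [abs_lt]; constructor <;> omega)
    omega
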